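/- Let σ be an absolutely continuous probability measure on ℝⁿ with finite second moment and μ a probability measure on ℝⁿ with finite second moment. Assume there exists L > 0 such that for every θ ∈ S^{n-1} the one-dimensional optimal transport map T_{σ^θ}^{μ^θ} is L-Lipschitz on ℝ. Then for all P, Q ∈ O(n), (∫ ‖T_{σ,μ;P}(x) − T_{σ,μ;Q}(x)‖² dσ(x))^{1/2} ≤ (3L + 1) C ‖P − Q‖_F, where C = max{M₂(σ)^{1/2}, M₂(μ)^{1/2}} and ‖·‖_F denotes the Frobenius norm of an n × n matrix. -/

import Mathlib

open MeasureTheory Filter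
open scoped ENNReal RealInnerProductSpace BigOperators Topology

noncomputable section

namespace SliceMatching

/-- `ℝⁿ` with its Euclidean structure. -/
abbrev Rn (n : ℕ) := EuclideanSpace ℝ (Fin n)

/-- The cumulative distribution function of a measure on `ℝ`. -/
def cdf (ν : Measure ℝ) (t : ℝ) : ℝ := (ν (Set.Iic t)).toReal

/-- The quantile function (pseudo-inverse of the CDF) of a measure on `ℝ`. -/
def quantile (ρ : Measure ℝ) (p : ℝ) : ℝ := sInf {t : ℝ | p ≤ cdf ρ t}

/-- The one-dimensional optimal transport map `T_ν^ρ = F_ρ⁻¹ ∘ F_ν`. -/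
def otMap1d (ν ρ : Measure ℝ) (t : ℝ) : ℝ := quantile ρ (cdf ν t)

/-- The slice `σ^θ`: pushforward of `σ` under the projection `x ↦ ⟪x, θ⟫`. -/
def slice {n : ℕ} (σ : Measure (Rn n)) (θ : Rn n) : Measure ℝ :=
  σ.map (fun x => ⟪x, θ⟫)

/-- The matrix-slice matching map `T_{σ,μ;P}`, where `P ∈ O(n)` has columns `θ 0, …, θ (n-1)`:
`T_{σ,μ;P}(x) = ∑ i, T_{σ^{θ i}}^{μ^{θ i}}(⟪x, θ i⟫) • θ i`. -/
def smMap {n : ℕ} (σ μ : Measure (Rn n)) (θ : Fin n → Rn n) (x : Rn n) : Rn n :=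
  ∑ i, otMap1d (slice σ (θ i)) (slice μ (θ i)) ⟪x, θ i⟫ • θ i

/-- The squared quadratic Wasserstein distance: the infimum of `∫ ‖x - y‖²` over all
couplings of `σ` and `μ`. -/
def W2sq {α : Type*} [MeasurableSpace α] [NormedAddCommGroup α] (σ μ : Measure α) : ℝ :=
  (⨅ (π : Measure (α × α)) (_ : π.map Prod.fst = σ ∧ π.map Prod.snd = μ),
    ∫⁻ p, ENNReal.ofReal (‖p.1 - p.2‖ ^ 2) ∂π).toReal

/-- The quadratic Wasserstein distance `W₂`. -/
def W2 {α : Type*} [MeasurableSpace α] [NormedAddCommGroup α] (σ μ : Measure α) : ℝ :=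
  Real.sqrt (W2sq σ μ)

theorem cdf_eq_probCdf (ν : Measure ℝ) [IsProbabilityMeasure ν] :
    cdf ν = ProbabilityTheory.cdf ν := by
  ext t
  rw [ProbabilityTheory.cdf_eq_real]
  rfl

theorem ofReal_cdf (ν : Measure ℝ) [IsProbabilityMeasure ν] (t : ℝ) :
    ENNReal.ofReal (cdf ν t) = ν (Set.Iic t) :=
  ENNReal.ofReal_toReal (measure_ne_top _ _)

theorem monotone_cdf (ν : Measure ℝ) [IsProbabilityMeasure ν] : Monotone (cdf ν) := by
  rw [cdf_eq_probCdf]; exact ProbabilityTheory.monotone_cdf ν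

theorem cdf_nonneg (ν : Measure ℝ) (t : ℝ) : 0 ≤ cdf ν t := ENNReal.toReal_nonneg

theorem cdf_le_one (ν : Measure ℝ) [IsProbabilityMeasure ν] (t : ℝ) : cdf ν t ≤ 1 := by
  rw [cdf_eq_probCdf]; exact ProbabilityTheory.cdf_le_one ν t

theorem exists_le_cdf (ν : Measure ℝ) [IsProbabilityMeasure ν] {p : ℝ} (hp : p < 1) :
    ∃ t, p ≤ cdf ν t := by
  rw [cdf_eq_probCdf]
  exact (((ProbabilityTheory.tendsto_cdf_atTop ν).eventually_const_lt hp).mono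
    fun _ h => h.le).exists

theorem exists_cdf_lt (ν : Measure ℝ) [IsProbabilityMeasure ν] {p : ℝ} (hp : 0 < p) :
    ∃ t, cdf ν t < p := by
  rw [cdf_eq_probCdf]
  exact ((ProbabilityTheory.tendsto_cdf_atBot ν).eventually_lt_const hp).exists

theorem continuous_cdf (ν : Measure ℝ) [IsProbabilityMeasure ν] [NullSingletonClass ν] :
    Continuous (cdf ν) := by
  rw [cdf_eq_probCdf, continuous_iff_continuousAt]
  intro x
  set F := ProbabilityTheory.cdf ν
  have h : F.measure {x} = 0 := by rw [ProbabilityTheory.measure_cdf]; exact measure_singleton x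
  rw [StieltjesFunction.measure_singleton, ENNReal.ofReal_eq_zero] at h
  rw [F.mono.continuousAt_iff_leftLim_eq_rightLim, F.rightLim_eq]
  exact le_antisymm (F.mono.leftLim_le le_rfl) (by linarith)

/-- The quantile function and the CDF form a Galois connection on `(0, 1)`. -/
theorem quantile_le_iff (ρ : Measure ℝ) [IsProbabilityMeasure ρ] {p : ℝ} (hp0 : 0 < p)
    (hp1 : p < 1) (t : ℝ) : quantile ρ p ≤ t ↔ p ≤ cdf ρ t := by
  obtain ⟨b, hb⟩ := exists_cdf_lt ρ hp0
  have hbdd : BddBelow {t : ℝ | p ≤ cdf ρ t} :=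
    ⟨b, fun s hs => le_of_lt ((monotone_cdf ρ).reflect_lt (hb.trans_le hs))⟩
  refine ⟨fun h => ?_, fun h => csInf_le hbdd h⟩
  have hev : ∀ u, t < u → p ≤ cdf ρ u := fun u hu => by
    obtain ⟨s, hs, hsu⟩ := exists_lt_of_csInf_lt (exists_le_cdf ρ hp1) (h.trans_lt hu)
    exact le_trans hs (monotone_cdf ρ hsu.le)
  have hc : ContinuousWithinAt (cdf ρ) (Set.Ioi t) t := by
    rw [cdf_eq_probCdf]
    exact ((ProbabilityTheory.cdf ρ).right_continuous t).mono Set.Ioi_subset_Ici_self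
  exact ge_of_tendsto hc (eventually_mem_nhdsWithin.mono fun u hu => hev u hu)

theorem monotoneOn_quantile (ρ : Measure ℝ) [IsProbabilityMeasure ρ] :
    MonotoneOn (quantile ρ) (Set.Ioo 0 1) := fun p hp q hq hpq => by
  rw [quantile_le_iff ρ hp.1 hp.2]
  exact hpq.trans ((quantile_le_iff ρ hq.1 hq.2 _).1 le_rfl)

/-- The CDF of an atomless probability measure is uniformly distributed. -/
theorem measure_cdf_le (ν : Measure ℝ) [IsProbabilityMeasure ν] [NullSingletonClass ν] {c : ℝ}
    (hc0 : 0 ≤ c) (hc1 : c ≤ 1) : ν {t | cdf ν t ≤ c} = ENNReal.ofReal c := by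
  have hex : ∀ p, 0 < p → p < 1 → ∃ t, cdf ν t = p := fun p hp0 hp1 => by
    obtain ⟨a, ha⟩ := exists_cdf_lt ν hp0
    obtain ⟨b, hb⟩ := exists_le_cdf ν hp1
    exact mem_range_of_exists_le_of_exists_ge (continuous_cdf ν) ⟨a, ha.le⟩ ⟨b, hb⟩
  rcases hc1.eq_or_lt with rfl | hc1
  · simp [cdf_le_one]
  apply le_antisymm
  · refine ENNReal.le_of_forall_pos_le_add fun ε hε _ => ?_
    rcases lt_or_ge (c + ε) 1 with h1 | h1
    · obtain ⟨t, ht⟩ := hex (c + ε) (by positivity) h1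
      calc ν {t | cdf ν t ≤ c} ≤ ν (Set.Iic t) := by
            refine measure_mono fun s hs => le_of_lt ((monotone_cdf ν).reflect_lt ?_)
            rw [ht]
            exact lt_of_le_of_lt hs (lt_add_of_pos_right c (by exact_mod_cast hε))
        _ = ENNReal.ofReal (c + ε) := by rw [← ofReal_cdf, ht]
        _ = _ := by rw [ENNReal.ofReal_add hc0 ε.coe_nonneg, ENNReal.ofReal_coe_nnreal]
    · calc ν {t | cdf ν t ≤ c} ≤ 1 := prob_le_one
        _ ≤ ENNReal.ofReal (c + ε) := by simpa using ENNReal.ofReal_le_ofReal h1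
        _ = _ := by rw [ENNReal.ofReal_add hc0 ε.coe_nonneg, ENNReal.ofReal_coe_nnreal]
  · rcases hc0.eq_or_lt with rfl | hc0
    · simp
    obtain ⟨t, ht⟩ := hex c hc0 hc1
    rw [← ht, ofReal_cdf]
    exact measure_mono fun s hs => monotone_cdf ν hs

theorem ae_cdf_mem_Ioo (ν : Measure ℝ) [IsProbabilityMeasure ν] [NullSingletonClass ν] :
    ∀ᵐ t ∂ν, cdf ν t ∈ Set.Ioo 0 1 := by
  have hpos : ∀ᵐ t ∂ν, 0 < cdf ν t := by
    have h := measure_cdf_le ν le_rfl zero_le_one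
    rw [ENNReal.ofReal_zero] at h
    simpa [ae_iff] using h
  have hlt : ∀ᵐ t ∂ν, cdf ν t < 1 := by
    rw [ae_iff, ← nonpos_iff_eq_zero]
    refine ENNReal.le_of_forall_pos_le_add fun ε hε _ => ?_
    rw [zero_add]
    rcases le_total 1 (ε : ℝ) with h1 | h1
    · exact prob_le_one.trans (by exact_mod_cast h1)
    have hp : ν {t | cdf ν t ≤ 1 - ε} = ENNReal.ofReal (1 - ε) :=
      measure_cdf_le ν (by linarith) (by linarith [ε.2])
    calc ν {t | ¬ cdf ν t < 1} ≤ ν {t | cdf ν t ≤ 1 - ε}ᶜ := by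
          refine measure_mono fun t ht => ?_
          have hε' : (0 : ℝ) < ε := hε
          simp only [Set.mem_compl_iff, Set.mem_ofPred_eq, not_le, not_lt] at ht ⊢
          linarith
      _ = ENNReal.ofReal ε := by
          rw [prob_compl_eq_one_sub (measurableSet_le (monotone_cdf ν).measurable
            measurable_const), hp, ← ENNReal.ofReal_one, ← ENNReal.ofReal_sub _ (by linarith)]
          congr 1
          ring
      _ = ε := ENNReal.ofReal_coe_nnreal
  filter_upwards [hpos, hlt] with t h0 h1 using ⟨h0, h1⟩

theorem monotoneOn_otMap1d (ν ρ : Measure ℝ) [IsProbabilityMeasure ν] [IsProbabilityMeasure ρ] :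
    MonotoneOn (otMap1d ν ρ) {t | cdf ν t ∈ Set.Ioo 0 1} := fun _ hs _ ht hst =>
  monotoneOn_quantile ρ hs ht (monotone_cdf ν hst)

theorem measurableSet_cdf_mem_Ioo (ν : Measure ℝ) [IsProbabilityMeasure ν] :
    MeasurableSet {t | cdf ν t ∈ Set.Ioo 0 1} :=
  (monotone_cdf ν).measurable measurableSet_Ioo

theorem aemeasurable_otMap1d (ν ρ : Measure ℝ) [IsProbabilityMeasure ν] [NullSingletonClass ν]
    [IsProbabilityMeasure ρ] : AEMeasurable (otMap1d ν ρ) ν := by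
  have h := aemeasurable_restrict_of_monotoneOn (μ := ν) (measurableSet_cdf_mem_Ioo ν)
    (monotoneOn_otMap1d ν ρ)
  have hr : ν.restrict {t | cdf ν t ∈ Set.Ioo 0 1} = ν :=
    Measure.restrict_eq_self_of_ae_mem (ae_cdf_mem_Ioo ν)
  rwa [hr] at h

/-- The one-dimensional optimal transport map is a transport map. -/
theorem map_otMap1d (ν ρ : Measure ℝ) [IsProbabilityMeasure ν] [NullSingletonClass ν]
    [IsProbabilityMeasure ρ] : ν.map (otMap1d ν ρ) = ρ := by
  have hm := aemeasurable_otMap1d ν ρ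
  have := Measure.isProbabilityMeasure_map hm
  refine Measure.ext_of_Iic _ _ fun s => ?_
  rw [Measure.map_apply_of_aemeasurable hm measurableSet_Iic, ← ofReal_cdf,
    ← measure_cdf_le ν (cdf_nonneg ρ s) (cdf_le_one ρ s)]
  refine measure_congr ?_
  filter_upwards [ae_cdf_mem_Ioo ν] with t ht
  exact propext (quantile_le_iff ρ ht.1 ht.2 s)

/-- Layer-cake formula for `∫ (Y - X)₊²`. -/
theorem lintegral_ofReal_sub_sq {Ω : Type*} [MeasurableSpace Ω] {P : Measure Ω} [SFinite P]
    {X Y : Ω → ℝ} (hX : AEMeasurable X P) (hY : AEMeasurable Y P) :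
    ∫⁻ ω, ENNReal.ofReal (Y ω - X ω) ^ 2 ∂P =
      ∫⁻ z : ℝ × ℝ, P ({ω | X ω ≤ min z.1 z.2} \ {ω | Y ω ≤ max z.1 z.2}) := by
  wlog hm : Measurable X ∧ Measurable Y generalizing X Y
  · have hX' := hX.ae_eq_mk
    have hY' := hY.ae_eq_mk
    have := this hX.measurable_mk.aemeasurable hY.measurable_mk.aemeasurable
      ⟨hX.measurable_mk, hY.measurable_mk⟩
    convert this using 1
    · refine lintegral_congr_ae ?_
      filter_upwards [hX', hY'] with ω h1 h2
      rw [h1, h2]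
    · refine lintegral_congr fun z => measure_congr ?_
      filter_upwards [hX', hY'] with ω h1 h2
      refine propext ?_
      change (X ω ≤ _ ∧ ¬ (Y ω ≤ _)) ↔ (hX.mk X ω ≤ _ ∧ ¬ (hY.mk Y ω ≤ _))
      rw [h1, h2]
  obtain ⟨hX, hY⟩ := hm
  let S : Set (Ω × (ℝ × ℝ)) := {w | X w.1 ≤ min w.2.1 w.2.2} \ {w | Y w.1 ≤ max w.2.1 w.2.2}
  have hS : MeasurableSet S :=
    (measurableSet_le (by fun_prop) (by fun_prop)).diff
      (measurableSet_le (by fun_prop) (by fun_prop))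
  calc ∫⁻ ω, ENNReal.ofReal (Y ω - X ω) ^ 2 ∂P
      = ∫⁻ ω, volume (Prod.mk ω ⁻¹' S) ∂P := by
        refine lintegral_congr fun ω => ?_
        have : Prod.mk ω ⁻¹' S = Set.Ico (X ω) (Y ω) ×ˢ Set.Ico (X ω) (Y ω) := by
          ext z
          simp only [S, Set.mem_preimage, Set.mem_sdiff, Set.mem_ofPred_eq, le_min_iff,
            Set.mem_prod, Set.mem_Ico, not_le, max_lt_iff]
          tauto
        rw [this, Measure.volume_eq_prod, Measure.prod_prod, Real.volume_Ico, sq]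
    _ = P.prod volume S := (Measure.prod_apply hS).symm
    _ = _ := Measure.prod_apply_symm hS

theorem enorm_sub_sq (x y : ℝ) :
    ‖x - y‖ₑ ^ 2 = ENNReal.ofReal (y - x) ^ 2 + ENNReal.ofReal (x - y) ^ 2 := by
  rcases le_total x y with h | h
  · rw [ENNReal.ofReal_of_nonpos (sub_nonpos.2 h), ← enorm_neg, neg_sub,
      Real.enorm_of_nonneg (sub_nonneg.2 h)]
    simp
  · rw [ENNReal.ofReal_of_nonpos (sub_nonpos.2 h), Real.enorm_of_nonneg (sub_nonneg.2 h)]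
    simp

theorem lintegral_ofReal_sub_sq_le {Ω Ω' : Type*} [MeasurableSpace Ω] [MeasurableSpace Ω']
    {P : Measure Ω} {P' : Measure Ω'} [IsFiniteMeasure P] [IsFiniteMeasure P']
    {X Y : Ω → ℝ} {X' Y' : Ω' → ℝ} (hX : AEMeasurable X P) (hY : AEMeasurable Y P)
    (hX' : AEMeasurable X' P') (hY' : AEMeasurable Y' P')
    (hXX : P'.map X' = P.map X) (hYY : P'.map Y' = P.map Y)
    {G : Set Ω'} (hG : ∀ᵐ ω ∂P', ω ∈ G) (hco : MonovaryOn X' Y' G) :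
    ∫⁻ ω, ENNReal.ofReal (Y' ω - X' ω) ^ 2 ∂P' ≤ ∫⁻ ω, ENNReal.ofReal (Y ω - X ω) ^ 2 ∂P := by
  rw [lintegral_ofReal_sub_sq hX hY, lintegral_ofReal_sub_sq hX' hY']
  refine lintegral_mono fun z => ?_
  have hA : P' {ω | X' ω ≤ min z.1 z.2} = P {ω | X ω ≤ min z.1 z.2} := by
    have := congrArg (fun m : Measure ℝ => m (Set.Iic (min z.1 z.2))) hXX
    rwa [Measure.map_apply_of_aemeasurable hX measurableSet_Iic,
      Measure.map_apply_of_aemeasurable hX' measurableSet_Iic] at this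
  have hB : P' {ω | Y' ω ≤ max z.1 z.2} = P {ω | Y ω ≤ max z.1 z.2} := by
    have := congrArg (fun m : Measure ℝ => m (Set.Iic (max z.1 z.2))) hYY
    rwa [Measure.map_apply_of_aemeasurable hY measurableSet_Iic,
      Measure.map_apply_of_aemeasurable hY' measurableSet_Iic] at this
  have hBm : NullMeasurableSet {ω | Y' ω ≤ max z.1 z.2} P' :=
    nullMeasurableSet_le hY' aemeasurable_const
  by_cases hsub : {ω | X' ω ≤ min z.1 z.2} ∩ G ⊆ {ω | Y' ω ≤ max z.1 z.2}
  · refine le_of_eq_of_le ?_ zero_le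
    rw [← ae_le_set]
    filter_upwards [hG] with ω hω h using hsub ⟨h, hω⟩
  · obtain ⟨ω₀, ⟨h1, h2⟩, h3⟩ := Set.not_subset.1 hsub
    have hle : {ω | Y' ω ≤ max z.1 z.2} ≤ᵐ[P'] {ω | X' ω ≤ min z.1 z.2} := by
      filter_upwards [hG] with ω hω h
      exact (hco hω h2 (lt_of_le_of_lt h (not_le.1 h3))).trans h1
    calc P' ({ω | X' ω ≤ min z.1 z.2} \ {ω | Y' ω ≤ max z.1 z.2})
        = P' {ω | X' ω ≤ min z.1 z.2} - P' {ω | Y' ω ≤ max z.1 z.2} := by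
          refine ENNReal.eq_sub_of_add_eq (measure_ne_top _ _) ?_
          rw [add_comm, ← measure_inter_add_sdiff₀ {ω | X' ω ≤ min z.1 z.2} hBm]
          congr 1
          refine measure_congr ?_
          filter_upwards [hle] with ω h
          exact propext ⟨fun hb => ⟨h hb, hb⟩, fun hb => hb.2⟩
      _ = P {ω | X ω ≤ min z.1 z.2} - P {ω | Y ω ≤ max z.1 z.2} := by rw [hA, hB]
      _ ≤ _ := le_measure_sdiff

/-- A comonotone coupling minimises the quadratic transport cost on the line. -/
theorem lintegral_enorm_sub_sq_le_of_monovaryOn {Ω Ω' : Type*} [MeasurableSpace Ω]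
    [MeasurableSpace Ω'] {P : Measure Ω} {P' : Measure Ω'} [IsFiniteMeasure P]
    [IsFiniteMeasure P'] {X Y : Ω → ℝ} {X' Y' : Ω' → ℝ}
    (hX : AEMeasurable X P) (hY : AEMeasurable Y P)
    (hX' : AEMeasurable X' P') (hY' : AEMeasurable Y' P')
    (hXX : P'.map X' = P.map X) (hYY : P'.map Y' = P.map Y)
    {G : Set Ω'} (hG : ∀ᵐ ω ∂P', ω ∈ G) (hco : MonovaryOn X' Y' G) :
    ∫⁻ ω, ‖X' ω - Y' ω‖ₑ ^ 2 ∂P' ≤ ∫⁻ ω, ‖X ω - Y ω‖ₑ ^ 2 ∂P := by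
  simp only [enorm_sub_sq]
  rw [lintegral_add_left' (by fun_prop), lintegral_add_left' (by fun_prop)]
  exact add_le_add (lintegral_ofReal_sub_sq_le hX hY hX' hY' hXX hYY hG hco)
    (lintegral_ofReal_sub_sq_le hY hX hY' hX' hYY hXX hG hco.symm)

theorem isProbabilityMeasure_slice {n : ℕ} (σ : Measure (Rn n)) [IsProbabilityMeasure σ]
    (θ : Rn n) : IsProbabilityMeasure (slice σ θ) :=
  Measure.isProbabilityMeasure_map (by fun_prop)

theorem nullSingletonClass_slice {n : ℕ} {σ : Measure (Rn n)} (hac : σ ≪ volume) {θ : Rn n}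
    (hθ : ‖θ‖ = 1) : NullSingletonClass (slice σ θ) := by
  refine ⟨fun c => ?_⟩
  rw [slice, Measure.map_apply (by fun_prop) (measurableSet_singleton c)]
  apply hac
  have hself : ⟪θ, θ⟫ = (1 : ℝ) := by rw [real_inner_self_eq_norm_sq, hθ, one_pow]
  let s : AffineSubspace ℝ (Rn n) := AffineSubspace.mk' (c • θ) (innerSL ℝ θ).ker
  have hmem : ∀ x, x ∈ s ↔ ⟪x, θ⟫ = c := fun x => by
    rw [AffineSubspace.mem_mk', LinearMap.mem_ker]
    simp only [vsub_eq_sub, ContinuousLinearMap.coe_coe, innerSL_apply_apply, inner_sub_right,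
      real_inner_smul_right, hself, mul_one, sub_eq_zero, real_inner_comm]
  have hs : s ≠ ⊤ := fun h => by
    have h1 := (hmem ((c + 1) • θ)).1 (h ▸ AffineSubspace.mem_top ℝ _ _)
    rw [real_inner_smul_left, hself] at h1
    linarith
  convert Measure.addHaar_affineSubspace volume s hs using 2
  ext x
  exact (hmem x).symm

theorem lintegral_slice {n : ℕ} {σ : Measure (Rn n)} {θ : Rn n} {φ : ℝ → ℝ≥0∞}
    (hφ : AEMeasurable φ (slice σ θ)) :
    ∫⁻ x, φ ⟪x, θ⟫ ∂σ = ∫⁻ t, φ t ∂(slice σ θ) :=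
  (lintegral_map' hφ (by fun_prop)).symm

theorem enorm_sq_eq_ofReal {E : Type*} [NormedAddCommGroup E] (v : E) :
    ‖v‖ₑ ^ 2 = ENNReal.ofReal (‖v‖ ^ 2) := by
  rw [← ofReal_norm, ENNReal.ofReal_pow (norm_nonneg _)]

theorem enorm_inner_sub_sq_le {n : ℕ} (x p q : Rn n) :
    ‖⟪x, p⟫ - ⟪x, q⟫‖ₑ ^ 2 ≤ ‖p - q‖ₑ ^ 2 * ‖x‖ₑ ^ 2 := by
  rw [← inner_sub_right, ← mul_pow, mul_comm]
  gcongr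
  rw [← ofReal_norm, ← ofReal_norm, ← ofReal_norm, ← ENNReal.ofReal_mul (norm_nonneg _)]
  exact ENNReal.ofReal_le_ofReal (norm_inner_le_norm _ _)

theorem enorm_sum_smul_sq {n : ℕ} {q : Fin n → Rn n} (hq : Orthonormal ℝ q) (a : Fin n → ℝ) :
    ‖∑ i, a i • q i‖ₑ ^ 2 = ∑ i, ‖a i‖ₑ ^ 2 := by
  simp only [enorm_sq_eq_ofReal]
  rw [← ENNReal.ofReal_sum_of_nonneg fun _ _ => by positivity, ← real_inner_self_eq_norm_sq,
    hq.inner_sum]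
  simp [sq]

theorem enorm_sum_smul_sq_le {n : ℕ} (v : Fin n → Rn n) (a : Fin n → ℝ) :
    ‖∑ i, a i • v i‖ₑ ^ 2 ≤ (∑ i, ‖v i‖ₑ ^ 2) * ∑ i, ‖a i‖ₑ ^ 2 := by
  simp only [enorm_sq_eq_ofReal]
  rw [← ENNReal.ofReal_sum_of_nonneg fun _ _ => by positivity,
    ← ENNReal.ofReal_sum_of_nonneg fun _ _ => by positivity,
    ← ENNReal.ofReal_mul (by positivity), mul_comm]
  refine ENNReal.ofReal_le_ofReal ?_
  refine le_trans ?_ (Finset.sum_mul_sq_le_sq_mul_sq _ _ _)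
  gcongr
  simpa only [norm_smul] using norm_sum_le Finset.univ fun i => a i • v i

theorem exists_orthonormalBasis_eq {n : ℕ} {θ : Fin n → Rn n} (hθ : Orthonormal ℝ θ) :
    ∃ b : OrthonormalBasis (Fin n) ℝ (Rn n), ⇑b = θ :=
  ⟨OrthonormalBasis.mk hθ
    (hθ.linearIndependent.span_eq_top_of_card_eq_finrank' (by simp)).ge, by simp⟩

theorem sum_enorm_inner_sq {n : ℕ} {θ : Fin n → Rn n} (hθ : Orthonormal ℝ θ) (x : Rn n) :
    ∑ i, ‖⟪x, θ i⟫‖ₑ ^ 2 = ‖x‖ₑ ^ 2 := by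
  obtain ⟨b, rfl⟩ := exists_orthonormalBasis_eq hθ
  simp only [enorm_sq_eq_ofReal]
  rw [← ENNReal.ofReal_sum_of_nonneg fun _ _ => by positivity, b.sum_sq_norm_inner_left]

theorem sum_inner_smul {n : ℕ} {θ : Fin n → Rn n} (hθ : Orthonormal ℝ θ) (x : Rn n) :
    ∑ i, ⟪x, θ i⟫ • θ i = x := by
  obtain ⟨b, rfl⟩ := exists_orthonormalBasis_eq hθ
  simpa only [real_inner_comm] using b.sum_repr' x

theorem lintegral_enorm_sq_eq_sum {Ω : Type*} [MeasurableSpace Ω] {n : ℕ} {P : Measure Ω}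
    {θ : Fin n → Rn n} (hθ : Orthonormal ℝ θ) {X : Ω → Rn n} (hX : AEMeasurable X P) :
    ∫⁻ x, ‖X x‖ₑ ^ 2 ∂P = ∑ i, ∫⁻ x, ‖⟪X x, θ i⟫‖ₑ ^ 2 ∂P := by
  simp only [← sum_enorm_inner_sq hθ]
  exact lintegral_finsetSum' _ fun i _ => by fun_prop

/-- The mean minimises the mean squared deviation. -/
theorem lintegral_enorm_sub_mean_sq_le {Ω : Type*} [MeasurableSpace Ω] {P : Measure Ω}
    [IsProbabilityMeasure P] {Y : Ω → ℝ} (hY : MemLp Y 2 P) (c : ℝ) :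
    ∫⁻ ω, ‖Y ω - ∫ ω', Y ω' ∂P‖ₑ ^ 2 ∂P ≤ ∫⁻ ω, ‖Y ω - c‖ₑ ^ 2 ∂P := by
  have hc : MemLp (fun ω => Y ω - c) 2 P := hY.sub (memLp_const c)
  calc ∫⁻ ω, ‖Y ω - ∫ ω', Y ω' ∂P‖ₑ ^ 2 ∂P
      = ENNReal.ofReal (ProbabilityTheory.variance Y P) := (hY.ofReal_variance_eq).symm
    _ = ENNReal.ofReal (ProbabilityTheory.variance (fun ω => Y ω - c) P) := by
        rw [ProbabilityTheory.variance_sub_const hY.aestronglyMeasurable]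
    _ ≤ ENNReal.ofReal (∫ ω, (Y ω - c) ^ 2 ∂P) :=
        ENNReal.ofReal_le_ofReal
          (ProbabilityTheory.variance_le_expectation_sq hc.aestronglyMeasurable)
    _ = ∫⁻ ω, ‖Y ω - c‖ₑ ^ 2 ∂P := by
        rw [ofReal_integral_eq_lintegral_ofReal hc.integrable_sq
          (Eventually.of_forall fun _ => sq_nonneg _)]
        simp only [enorm_sq_eq_ofReal, Real.norm_eq_abs, sq_abs]

theorem enorm_sub_sq_le_of_lipschitzWith {f : ℝ → ℝ} {K : NNReal} (hf : LipschitzWith K f)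
    (s t : ℝ) : ‖f s - f t‖ₑ ^ 2 ≤ (K : ℝ≥0∞) ^ 2 * ‖s - t‖ₑ ^ 2 := by
  rw [← mul_pow]
  gcongr
  simpa only [edist_eq_enorm_sub] using hf s t

theorem memLp_inner {n : ℕ} {μ : Measure (Rn n)} (hμ : MemLp id 2 μ) (θ : Rn n) :
    MemLp (fun y => ⟪y, θ⟫) 2 μ := by
  simpa only [real_inner_comm, Function.comp_def, id, innerSL_apply_apply] using
    (innerSL ℝ θ).comp_memLp' hμ

section

variable {n : ℕ} {σ μ : Measure (Rn n)} [IsProbabilityMeasure σ] [IsProbabilityMeasure μ]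

theorem integral_inner_left (hμ : MemLp id 2 μ) (θ : Rn n) :
    ∫ y, ⟪y, θ⟫ ∂μ = ⟪∫ y, y ∂μ, θ⟫ := by
  have h := integral_inner (𝕜 := ℝ) (hμ.integrable (by norm_num)) θ
  simpa only [real_inner_comm, id] using h

theorem lintegral_enorm_otMap1d_sub_sq (hac : σ ≪ volume) {θ : Rn n} (hθ : ‖θ‖ = 1)
    (hf : Measurable (otMap1d (slice σ θ) (slice μ θ))) (c : ℝ) :
    ∫⁻ x, ‖otMap1d (slice σ θ) (slice μ θ) ⟪x, θ⟫ - c‖ₑ ^ 2 ∂σ =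
      ∫⁻ y, ‖⟪y, θ⟫ - c‖ₑ ^ 2 ∂μ := by
  have := isProbabilityMeasure_slice σ θ
  have := isProbabilityMeasure_slice μ θ
  have := nullSingletonClass_slice hac hθ
  rw [lintegral_slice (φ := fun t => ‖otMap1d (slice σ θ) (slice μ θ) t - c‖ₑ ^ 2)
    (by fun_prop), lintegral_slice (φ := fun t => ‖t - c‖ₑ ^ 2) (by fun_prop)]
  conv_rhs => rw [← map_otMap1d (slice σ θ) (slice μ θ)]
  rw [lintegral_map (by fun_prop) hf]

/-- If the optimal maps between slices are `K`-Lipschitz, the spread of the target is at most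
`K` times the size of the source. -/
theorem lintegral_enorm_inner_sub_mean_sq_le (hac : σ ≪ volume) (hμ : MemLp id 2 μ) {K : NNReal}
    {θ : Rn n} (hθ : ‖θ‖ = 1) (hf : LipschitzWith K (otMap1d (slice σ θ) (slice μ θ))) :
    ∫⁻ y, ‖⟪y - ∫ z, z ∂μ, θ⟫‖ₑ ^ 2 ∂μ ≤ (K : ℝ≥0∞) ^ 2 * ∫⁻ x, ‖⟪x, θ⟫‖ₑ ^ 2 ∂σ := by
  set f := otMap1d (slice σ θ) (slice μ θ)
  calc ∫⁻ y, ‖⟪y - ∫ z, z ∂μ, θ⟫‖ₑ ^ 2 ∂μ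
      = ∫⁻ y, ‖⟪y, θ⟫ - ∫ z, ⟪z, θ⟫ ∂μ‖ₑ ^ 2 ∂μ := by
        simp only [integral_inner_left hμ, inner_sub_left]
    _ ≤ ∫⁻ y, ‖⟪y, θ⟫ - f 0‖ₑ ^ 2 ∂μ := lintegral_enorm_sub_mean_sq_le (memLp_inner hμ θ) _
    _ = ∫⁻ x, ‖f ⟪x, θ⟫ - f 0‖ₑ ^ 2 ∂σ :=
        (lintegral_enorm_otMap1d_sub_sq hac hθ hf.continuous.measurable _).symm
    _ ≤ ∫⁻ x, (K : ℝ≥0∞) ^ 2 * ‖⟪x, θ⟫‖ₑ ^ 2 ∂σ := lintegral_mono fun x => by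
        simpa only [sub_zero] using enorm_sub_sq_le_of_lipschitzWith hf ⟪x, θ⟫ 0
    _ = _ := lintegral_const_mul _ (by fun_prop)

theorem lintegral_enorm_sub_mean_sq_le_mul (hac : σ ≪ volume) (hμ : MemLp id 2 μ) {K : NNReal}
    {θ : Fin n → Rn n} (hθ : Orthonormal ℝ θ)
    (hf : ∀ i, LipschitzWith K (otMap1d (slice σ (θ i)) (slice μ (θ i)))) :
    ∫⁻ y, ‖y - ∫ z, z ∂μ‖ₑ ^ 2 ∂μ ≤ (K : ℝ≥0∞) ^ 2 * ∫⁻ x, ‖x‖ₑ ^ 2 ∂σ := by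
  rw [lintegral_enorm_sq_eq_sum hθ (by fun_prop),
    lintegral_enorm_sq_eq_sum (X := fun x => x) hθ (by fun_prop), Finset.mul_sum]
  exact Finset.sum_le_sum fun i _ =>
    lintegral_enorm_inner_sub_mean_sq_le hac hμ (hθ.1 i) (hf i)

theorem lintegral_enorm_sub_mean_sq_le_lintegral (hμ : MemLp id 2 μ) :
    ∫⁻ y, ‖y - ∫ z, z ∂μ‖ₑ ^ 2 ∂μ ≤ ∫⁻ y, ‖y‖ₑ ^ 2 ∂μ := by
  have hθ := (EuclideanSpace.basisFun (Fin n) ℝ).orthonormal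
  rw [lintegral_enorm_sq_eq_sum hθ (by fun_prop),
    lintegral_enorm_sq_eq_sum (X := fun x => x) hθ (by fun_prop)]
  refine Finset.sum_le_sum fun i _ => ?_
  simpa only [integral_inner_left hμ, inner_sub_left, sub_zero] using
    lintegral_enorm_sub_mean_sq_le (memLp_inner hμ (EuclideanSpace.basisFun (Fin n) ℝ i)) 0

/-- The optimal map from `σ^q` to `σ^p` costs at most as much as the coupling of these slices
given by `σ`. -/
theorem lintegral_enorm_sub_otMap1d_slice_sq_le (hac : σ ≪ volume) {p q : Rn n} (hq : ‖q‖ = 1) :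
    ∫⁻ x, ‖otMap1d (slice σ q) (slice σ p) ⟪x, q⟫ - ⟪x, q⟫‖ₑ ^ 2 ∂σ ≤
      ∫⁻ x, ‖⟪x, p⟫ - ⟪x, q⟫‖ₑ ^ 2 ∂σ := by
  have := isProbabilityMeasure_slice σ p
  have := isProbabilityMeasure_slice σ q
  have := nullSingletonClass_slice hac hq
  have hm := aemeasurable_otMap1d (slice σ q) (slice σ p)
  rw [lintegral_slice (φ := fun t => ‖otMap1d (slice σ q) (slice σ p) t - t‖ₑ ^ 2)
    (by fun_prop)]
  refine lintegral_enorm_sub_sq_le_of_monovaryOn (by fun_prop) (by fun_prop) hm (by fun_prop)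
    (map_otMap1d _ _) Measure.map_id (ae_cdf_mem_Ioo (slice σ q)) ?_
  exact (monotoneOn_otMap1d _ _).monovaryOn monotoneOn_id

/-- With `h` the optimal map from `σ^q` to `σ^p`, the maps `T_{σ^p}^{μ^p} ∘ h` and `T_{σ^q}^{μ^q}`
are comonotone, so their distance in `L²(σ^q)` is bounded through the coupling of `μ^p` and `μ^q`
given by `μ`. -/
theorem lintegral_enorm_otMap1d_comp_sub_sq_le (hac : σ ≪ volume) {p q : Rn n} (hp : ‖p‖ = 1)
    (hq : ‖q‖ = 1) (hf : Measurable (otMap1d (slice σ p) (slice μ p)))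
    (hg : Measurable (otMap1d (slice σ q) (slice μ q))) (a b : ℝ) :
    ∫⁻ x, ‖(otMap1d (slice σ p) (slice μ p) (otMap1d (slice σ q) (slice σ p) ⟪x, q⟫) - a) -
        (otMap1d (slice σ q) (slice μ q) ⟪x, q⟫ - b)‖ₑ ^ 2 ∂σ ≤
      ∫⁻ y, ‖(⟪y, p⟫ - a) - (⟪y, q⟫ - b)‖ₑ ^ 2 ∂μ := by
  have := isProbabilityMeasure_slice σ p
  have := isProbabilityMeasure_slice σ q
  have := isProbabilityMeasure_slice μ p
  have := isProbabilityMeasure_slice μ q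
  have := nullSingletonClass_slice hac hq
  have := nullSingletonClass_slice hac hp
  have hm := aemeasurable_otMap1d (slice σ q) (slice σ p)
  have hmap := map_otMap1d (slice σ q) (slice σ p)
  have hmf := map_otMap1d (slice σ p) (slice μ p)
  have hmg := map_otMap1d (slice σ q) (slice μ q)
  have hmonf := monotoneOn_otMap1d (slice σ p) (slice μ p)
  have hmong := monotoneOn_otMap1d (slice σ q) (slice μ q)
  have hmonh := monotoneOn_otMap1d (slice σ q) (slice σ p)
  set f := otMap1d (slice σ p) (slice μ p)
  set g := otMap1d (slice σ q) (slice μ q)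
  set h := otMap1d (slice σ q) (slice σ p)
  have hfh : AEMeasurable (fun t => f (h t)) (slice σ q) := hf.comp_aemeasurable hm
  rw [lintegral_slice (φ := fun t => ‖(f (h t) - a) - (g t - b)‖ₑ ^ 2)
    (((hfh.sub_const a).sub (hg.aemeasurable.sub_const b)).enorm.pow_const 2)]
  have hGp : ∀ᵐ s ∂(slice σ q).map h, cdf (slice σ p) s ∈ Set.Ioo 0 1 := by
    rw [hmap]
    exact ae_cdf_mem_Ioo (slice σ p)
  have hG := (ae_cdf_mem_Ioo (slice σ q)).and (ae_of_ae_map hm hGp)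
  refine lintegral_enorm_sub_sq_le_of_monovaryOn (by fun_prop) (by fun_prop) (by fun_prop)
    (by fun_prop) ?_ ?_ hG ?_
  · have e1 : (slice σ q).map (fun t => f (h t)) = slice μ p := by
      rw [← hmf, ← hmap, AEMeasurable.map_map_of_aemeasurable hf.aemeasurable hm]
      rfl
    have e2 := AEMeasurable.map_map_of_aemeasurable (g := fun s : ℝ => s - a) (by fun_prop) hfh
    have e3 := AEMeasurable.map_map_of_aemeasurable (μ := μ) (g := fun s : ℝ => s - a)
      (f := fun y => ⟪y, p⟫) (by fun_prop) (by fun_prop)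
    rw [e1] at e2
    exact e2.symm.trans e3
  · have e2 := AEMeasurable.map_map_of_aemeasurable (μ := slice σ q) (g := fun s : ℝ => s - b)
      (f := g) (by fun_prop) (by fun_prop)
    have e3 := AEMeasurable.map_map_of_aemeasurable (μ := μ) (g := fun s : ℝ => s - b)
      (f := fun y => ⟪y, q⟫) (by fun_prop) (by fun_prop)
    rw [hmg] at e2
    exact e2.symm.trans e3
  · refine MonotoneOn.monovaryOn (fun s hs t ht hst => ?_) (fun s hs t ht hst => ?_)
    · exact sub_le_sub_right (hmonf hs.2 ht.2 (hmonh hs.1 ht.1 hst)) a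
    · exact sub_le_sub_right (hmong hs.1 ht.1 hst) b

end

theorem eLpNorm_sq_eq_lintegral {n : ℕ} {σ : Measure (Rn n)} (F : Rn n → Rn n) :
    eLpNorm F 2 σ ^ 2 = ∫⁻ x, ‖F x‖ₑ ^ 2 ∂σ := by
  have h := eLpNorm_nnreal_pow_eq_lintegral (f := F) (μ := σ) (p := 2) two_ne_zero
  simpa using h

theorem eLpNorm_sum_smul_sq_le {n : ℕ} {σ : Measure (Rn n)} {q : Fin n → Rn n}
    (hq : Orthonormal ℝ q) {a : Fin n → Rn n → ℝ} (ha : ∀ i, AEMeasurable (a i) σ)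
    {c : Fin n → ℝ≥0∞} {B : ℝ≥0∞}
    (hc : ∀ i, ∫⁻ x, ‖a i x‖ₑ ^ 2 ∂σ ≤ c i * B) :
    eLpNorm (fun x => ∑ i, a i x • q i) 2 σ ^ 2 ≤ (∑ i, c i) * B := by
  rw [eLpNorm_sq_eq_lintegral, Finset.sum_mul]
  simp only [enorm_sum_smul_sq hq]
  rw [lintegral_finsetSum' _ fun i _ => by fun_prop]
  exact Finset.sum_le_sum fun i _ => hc i


theorem eLpNorm_sum_smul_sq_le_mul {n : ℕ} {σ : Measure (Rn n)} {a : Fin n → Rn n → ℝ}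
    (ha : ∀ i, AEMeasurable (a i) σ) (v : Fin n → Rn n) :
    eLpNorm (fun x => ∑ i, a i x • v i) 2 σ ^ 2 ≤
      (∑ i, ‖v i‖ₑ ^ 2) * ∑ i, ∫⁻ x, ‖a i x‖ₑ ^ 2 ∂σ := by
  rw [eLpNorm_sq_eq_lintegral, ← lintegral_finsetSum' _ fun i _ => by fun_prop,
    ← lintegral_const_mul'' _ (by fun_prop)]
  exact lintegral_mono fun x => enorm_sum_smul_sq_le _ _

theorem aestronglyMeasurable_sum_smul {n : ℕ} {σ : Measure (Rn n)} {a : Fin n → Rn n → ℝ}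
    (ha : ∀ i, AEMeasurable (a i) σ) (v : Fin n → Rn n) :
    AEStronglyMeasurable (fun x => ∑ i, a i x • v i) σ :=
  AEMeasurable.aestronglyMeasurable (by fun_prop)

theorem lintegral_enorm_sq_eq_ofReal_sqrt_sq {n : ℕ} {σ : Measure (Rn n)}
    (hσ : Integrable (fun x => ‖x‖ ^ 2) σ) :
    ∫⁻ x, ‖x‖ₑ ^ 2 ∂σ = ENNReal.ofReal (Real.sqrt (∫ x, ‖x‖ ^ 2 ∂σ)) ^ 2 := by
  have h0 : 0 ≤ ∫ x, ‖x‖ ^ 2 ∂σ := integral_nonneg fun _ => by positivity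
  rw [← ENNReal.ofReal_pow (Real.sqrt_nonneg _), Real.sq_sqrt h0,
    ofReal_integral_eq_lintegral_ofReal hσ (Eventually.of_forall fun _ => by positivity)]
  simp only [enorm_sq_eq_ofReal]

theorem sqrt_integral_norm_sq_le {n : ℕ} {σ : Measure (Rn n)} {F : Rn n → Rn n}
    (hF : AEStronglyMeasurable F σ) {c : ℝ} (hc : 0 ≤ c)
    (h : eLpNorm F 2 σ ≤ ENNReal.ofReal c) : Real.sqrt (∫ x, ‖F x‖ ^ 2 ∂σ) ≤ c := by
  refine Real.sqrt_le_iff.2 ⟨hc, ?_⟩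
  have hm : AEStronglyMeasurable (fun x => ‖F x‖ ^ 2) σ := hF.norm.pow 2
  rw [integral_eq_lintegral_of_nonneg_ae (Eventually.of_forall fun _ => by positivity) hm]
  simp only [← enorm_sq_eq_ofReal]
  rw [← eLpNorm_sq_eq_lintegral]
  refine ENNReal.toReal_le_of_le_ofReal (by positivity) ?_
  rw [ENNReal.ofReal_pow hc]
  gcongr

theorem smMap_sub_smMap_eq {n : ℕ} (σ μ : Measure (Rn n)) {p q : Fin n → Rn n}
    (hp : Orthonormal ℝ p) (hq : Orthonormal ℝ q) (m : Rn n) (h : Fin n → ℝ → ℝ) (x : Rn n) :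
    smMap σ μ p x - smMap σ μ q x =
      ((∑ i, (otMap1d (slice σ (p i)) (slice μ (p i)) ⟪x, p i⟫ - ⟪m, p i⟫) • (p i - q i)) +
      ∑ i, (otMap1d (slice σ (p i)) (slice μ (p i)) ⟪x, p i⟫ -
        otMap1d (slice σ (p i)) (slice μ (p i)) ⟪x, q i⟫) • q i) +
      ((∑ i, (otMap1d (slice σ (p i)) (slice μ (p i)) ⟪x, q i⟫ -
        otMap1d (slice σ (p i)) (slice μ (p i)) (h i ⟪x, q i⟫)) • q i) +
      ∑ i, ((otMap1d (slice σ (p i)) (slice μ (p i)) (h i ⟪x, q i⟫) - ⟪m, p i⟫) -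
        (otMap1d (slice σ (q i)) (slice μ (q i)) ⟪x, q i⟫ - ⟪m, q i⟫)) • q i) := by
  have hm : ∑ i, ⟪m, p i⟫ • p i = ∑ i, ⟪m, q i⟫ • q i := by
    rw [sum_inner_smul hp, sum_inner_smul hq]
  simp only [smMap, sub_smul, smul_sub, Finset.sum_sub_distrib, hm]
  abel

/-- Lipschitz continuity of the matrix-slice matching map with respect to
the slicing directions, with constant `(3L+1)·C` in the Frobenius norm `‖P - Q‖_F`. -/
theorem stmt7 {n : ℕ}
    (σ μ : Measure (Rn n)) [IsProbabilityMeasure σ] [IsProbabilityMeasure μ]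
    (hac : σ ≪ volume)
    (hσ2 : Integrable (fun x => ‖x‖ ^ 2) σ) (hμ2 : Integrable (fun y => ‖y‖ ^ 2) μ)
    (L : ℝ) (hL : 0 < L)
    (hLip : ∀ θ : Rn n, ‖θ‖ = 1 →
      LipschitzWith (Real.toNNReal L) (otMap1d (slice σ θ) (slice μ θ)))
    (θP θQ : Fin n → Rn n) (hθP : Orthonormal ℝ θP) (hθQ : Orthonormal ℝ θQ) :
    Real.sqrt (∫ x, ‖smMap σ μ θP x - smMap σ μ θQ x‖ ^ 2 ∂σ) ≤
      (3 * L + 1) *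
        max (Real.sqrt (∫ x, ‖x‖ ^ 2 ∂σ)) (Real.sqrt (∫ y, ‖y‖ ^ 2 ∂μ)) *
        Real.sqrt (∑ i, ‖θP i - θQ i‖ ^ 2) := by
  have hμ : MemLp id 2 μ := (memLp_two_iff_integrable_sq_norm aestronglyMeasurable_id).2 hμ2
  have hA := lintegral_enorm_sq_eq_ofReal_sqrt_sq hσ2
  have hM := lintegral_enorm_sq_eq_ofReal_sqrt_sq hμ2
  set C := max (Real.sqrt (∫ x, ‖x‖ ^ 2 ∂σ)) (Real.sqrt (∫ y, ‖y‖ ^ 2 ∂μ))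
  set R := Real.sqrt (∑ i, ‖θP i - θQ i‖ ^ 2)
  have hC : 0 ≤ C := le_max_of_le_left (Real.sqrt_nonneg _)
  have hR : 0 ≤ R := Real.sqrt_nonneg _
  set K := Real.toNNReal L
  have hAC : ∫⁻ x, ‖x‖ₑ ^ 2 ∂σ ≤ ENNReal.ofReal C ^ 2 := by
    rw [hA]; gcongr; exact le_max_left _ _
  have hMC : ∫⁻ y, ‖y‖ₑ ^ 2 ∂μ ≤ ENNReal.ofReal C ^ 2 := by
    rw [hM]; gcongr; exact le_max_right _ _
  have hS : ∑ i, ‖θP i - θQ i‖ₑ ^ 2 = ENNReal.ofReal R ^ 2 := by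
    simp only [enorm_sq_eq_ofReal]
    rw [← ENNReal.ofReal_sum_of_nonneg fun _ _ => by positivity, ← ENNReal.ofReal_pow hR,
      Real.sq_sqrt (by positivity)]
  set m := ∫ y, y ∂μ
  have hpu := hθP.1
  have hqu := hθQ.1
  have hfL := fun i => hLip (θP i) (hpu i)
  have hgL := fun i => hLip (θQ i) (hqu i)
  have hfm := fun i => (hfL i).continuous.measurable
  have hgm := fun i => (hgL i).continuous.measurable
  have hBM : ∫⁻ y, ‖y - m‖ₑ ^ 2 ∂μ ≤ ENNReal.ofReal C ^ 2 :=
    (lintegral_enorm_sub_mean_sq_le_lintegral hμ).trans hMC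
  have hBK : ∫⁻ y, ‖y - m‖ₑ ^ 2 ∂μ ≤ (K : ℝ≥0∞) ^ 2 * ENNReal.ofReal C ^ 2 :=
    (lintegral_enorm_sub_mean_sq_le_mul hac hμ hθP hfL).trans (by gcongr)
  have hslice : ∀ i, ∫⁻ x, ‖⟪x, θP i⟫ - ⟪x, θQ i⟫‖ₑ ^ 2 ∂σ ≤
      ‖θP i - θQ i‖ₑ ^ 2 * ENNReal.ofReal C ^ 2 := fun i => calc
    _ ≤ ∫⁻ x, ‖θP i - θQ i‖ₑ ^ 2 * ‖x‖ₑ ^ 2 ∂σ :=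
      lintegral_mono fun x => enorm_inner_sub_sq_le x _ _
    _ = ‖θP i - θQ i‖ₑ ^ 2 * ∫⁻ x, ‖x‖ₑ ^ 2 ∂σ := lintegral_const_mul _ (by fun_prop)
    _ ≤ _ := by gcongr
  let f := fun i => otMap1d (slice σ (θP i)) (slice μ (θP i))
  let g := fun i => otMap1d (slice σ (θQ i)) (slice μ (θQ i))
  let h := fun i => otMap1d (slice σ (θQ i)) (slice σ (θP i))
  have hfp : ∀ i, AEMeasurable (fun x => f i ⟪x, θP i⟫) σ := fun i =>
    ((hfm i).comp (by fun_prop)).aemeasurable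
  have hfq : ∀ i, AEMeasurable (fun x => f i ⟪x, θQ i⟫) σ := fun i =>
    ((hfm i).comp (by fun_prop)).aemeasurable
  have hgq : ∀ i, AEMeasurable (fun x => g i ⟪x, θQ i⟫) σ := fun i =>
    ((hgm i).comp (by fun_prop)).aemeasurable
  have hhq : ∀ i, AEMeasurable (fun x => h i ⟪x, θQ i⟫) σ := fun i => by
    have := isProbabilityMeasure_slice σ (θP i)
    have := isProbabilityMeasure_slice σ (θQ i)
    have := nullSingletonClass_slice hac (hqu i)
    exact (aemeasurable_otMap1d (slice σ (θQ i)) (slice σ (θP i))).comp_aemeasurable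
      (by fun_prop)
  have hfh : ∀ i, AEMeasurable (fun x => f i (h i ⟪x, θQ i⟫)) σ := fun i =>
    (hfm i).comp_aemeasurable (hhq i)
  let D₁ : Rn n → Rn n := fun x => ∑ i, (f i ⟪x, θP i⟫ - ⟪m, θP i⟫) • (θP i - θQ i)
  let D₂ : Rn n → Rn n := fun x => ∑ i, (f i ⟪x, θP i⟫ - f i ⟪x, θQ i⟫) • θQ i
  let D₃ : Rn n → Rn n := fun x => ∑ i, (f i ⟪x, θQ i⟫ - f i (h i ⟪x, θQ i⟫)) • θQ i
  let D₄ : Rn n → Rn n := fun x =>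
    ∑ i, ((f i (h i ⟪x, θQ i⟫) - ⟪m, θP i⟫) - (g i ⟪x, θQ i⟫ - ⟪m, θQ i⟫)) • θQ i
  have hD₁ : AEStronglyMeasurable D₁ σ :=
    aestronglyMeasurable_sum_smul (fun i => (hfp i).sub_const _) _
  have hD₂ : AEStronglyMeasurable D₂ σ :=
    aestronglyMeasurable_sum_smul (fun i => (hfp i).sub (hfq i)) _
  have hD₃ : AEStronglyMeasurable D₃ σ :=
    aestronglyMeasurable_sum_smul (fun i => (hfq i).sub (hfh i)) _
  have hD₄ : AEStronglyMeasurable D₄ σ :=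
    aestronglyMeasurable_sum_smul (fun i =>
      ((hfh i).sub_const _).sub ((hgq i).sub_const _)) _
  have hD : (fun x => smMap σ μ θP x - smMap σ μ θQ x) = (D₁ + D₂) + (D₃ + D₄) :=
    funext fun x => smMap_sub_smMap_eq σ μ hθP hθQ m h x
  have hN₁ : eLpNorm D₁ 2 σ ≤ ENNReal.ofReal (C * R) := by
    rw [← ENNReal.pow_le_pow_left_iff two_ne_zero]
    calc eLpNorm D₁ 2 σ ^ 2
        ≤ ENNReal.ofReal R ^ 2 * ∑ i, ∫⁻ x, ‖f i ⟪x, θP i⟫ - ⟪m, θP i⟫‖ₑ ^ 2 ∂σ :=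
          hS ▸ eLpNorm_sum_smul_sq_le_mul (fun i => (hfp i).sub_const _) _
      _ = ENNReal.ofReal R ^ 2 * ∫⁻ y, ‖y - m‖ₑ ^ 2 ∂μ := by
          rw [lintegral_enorm_sq_eq_sum hθP (by fun_prop)]
          simp only [inner_sub_left]
          congr 1
          exact Finset.sum_congr rfl fun i _ =>
            lintegral_enorm_otMap1d_sub_sq hac (hpu i) (hfm i) _
      _ ≤ ENNReal.ofReal R ^ 2 * ENNReal.ofReal C ^ 2 := by gcongr
      _ = ENNReal.ofReal (C * R) ^ 2 := by rw [ENNReal.ofReal_mul hC]; ring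
  have hsq : (∑ i, ‖θP i - θQ i‖ₑ ^ 2) * ((K : ℝ≥0∞) ^ 2 * ENNReal.ofReal C ^ 2) =
      ENNReal.ofReal (L * (C * R)) ^ 2 := by
    rw [hS, ENNReal.ofReal_mul hL.le, ENNReal.ofReal_mul hC]
    change _ * (ENNReal.ofReal L ^ 2 * _) = _
    ring
  have hN₂ : eLpNorm D₂ 2 σ ≤ ENNReal.ofReal (L * (C * R)) := by
    rw [← ENNReal.pow_le_pow_left_iff two_ne_zero, ← hsq]
    refine eLpNorm_sum_smul_sq_le hθQ (fun i => (hfp i).sub (hfq i)) fun i => ?_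
    calc ∫⁻ x, ‖f i ⟪x, θP i⟫ - f i ⟪x, θQ i⟫‖ₑ ^ 2 ∂σ
        ≤ ∫⁻ x, (K : ℝ≥0∞) ^ 2 * ‖⟪x, θP i⟫ - ⟪x, θQ i⟫‖ₑ ^ 2 ∂σ :=
          lintegral_mono fun x => enorm_sub_sq_le_of_lipschitzWith (hfL i) _ _
      _ = (K : ℝ≥0∞) ^ 2 * ∫⁻ x, ‖⟪x, θP i⟫ - ⟪x, θQ i⟫‖ₑ ^ 2 ∂σ :=
          lintegral_const_mul _ (by fun_prop)
      _ ≤ (K : ℝ≥0∞) ^ 2 * (‖θP i - θQ i‖ₑ ^ 2 * ENNReal.ofReal C ^ 2) := by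
          gcongr
          exact hslice i
      _ = _ := by ring
  have hN₃ : eLpNorm D₃ 2 σ ≤ ENNReal.ofReal (L * (C * R)) := by
    rw [← ENNReal.pow_le_pow_left_iff two_ne_zero, ← hsq]
    refine eLpNorm_sum_smul_sq_le hθQ (fun i => (hfq i).sub (hfh i)) fun i => ?_
    calc ∫⁻ x, ‖f i ⟪x, θQ i⟫ - f i (h i ⟪x, θQ i⟫)‖ₑ ^ 2 ∂σ
        ≤ ∫⁻ x, (K : ℝ≥0∞) ^ 2 * ‖h i ⟪x, θQ i⟫ - ⟪x, θQ i⟫‖ₑ ^ 2 ∂σ :=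
          lintegral_mono fun x => by
            rw [← enorm_neg (h i _ - _), neg_sub]
            exact enorm_sub_sq_le_of_lipschitzWith (hfL i) _ _
      _ = (K : ℝ≥0∞) ^ 2 * ∫⁻ x, ‖h i ⟪x, θQ i⟫ - ⟪x, θQ i⟫‖ₑ ^ 2 ∂σ :=
          lintegral_const_mul'' _ (((hhq i).sub (by fun_prop)).enorm.pow_const 2)
      _ ≤ (K : ℝ≥0∞) ^ 2 * (‖θP i - θQ i‖ₑ ^ 2 * ENNReal.ofReal C ^ 2) := by
          gcongr
          exact (lintegral_enorm_sub_otMap1d_slice_sq_le hac (hqu i)).trans (hslice i)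
      _ = _ := by ring
  have hN₄ : eLpNorm D₄ 2 σ ≤ ENNReal.ofReal (L * (C * R)) := by
    rw [← ENNReal.pow_le_pow_left_iff two_ne_zero, ← hsq]
    refine eLpNorm_sum_smul_sq_le hθQ
      (fun i => ((hfh i).sub_const _).sub ((hgq i).sub_const _)) fun i => ?_
    calc _ ≤ ∫⁻ y, ‖(⟪y, θP i⟫ - ⟪m, θP i⟫) - (⟪y, θQ i⟫ - ⟪m, θQ i⟫)‖ₑ ^ 2 ∂μ :=
          lintegral_enorm_otMap1d_comp_sub_sq_le hac (hpu i) (hqu i) (hfm i) (hgm i) _ _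
      _ ≤ ∫⁻ y, ‖θP i - θQ i‖ₑ ^ 2 * ‖y - m‖ₑ ^ 2 ∂μ := lintegral_mono fun y => by
          rw [← inner_sub_left, ← inner_sub_left]
          exact enorm_inner_sub_sq_le _ _ _
      _ = ‖θP i - θQ i‖ₑ ^ 2 * ∫⁻ y, ‖y - m‖ₑ ^ 2 ∂μ := lintegral_const_mul _ (by fun_prop)
      _ ≤ _ := by gcongr
  refine sqrt_integral_norm_sq_le (hD ▸ (hD₁.add hD₂).add (hD₃.add hD₄)) (by positivity) ?_
  rw [hD]
  calc eLpNorm ((D₁ + D₂) + (D₃ + D₄)) 2 σ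
      ≤ (eLpNorm D₁ 2 σ + eLpNorm D₂ 2 σ) + (eLpNorm D₃ 2 σ + eLpNorm D₄ 2 σ) :=
        (eLpNorm_add_le (hD₁.add hD₂) (hD₃.add hD₄) one_le_two).trans
          (add_le_add (eLpNorm_add_le hD₁ hD₂ one_le_two) (eLpNorm_add_le hD₃ hD₄ one_le_two))
    _ ≤ (ENNReal.ofReal (C * R) + ENNReal.ofReal (L * (C * R))) +
        (ENNReal.ofReal (L * (C * R)) + ENNReal.ofReal (L * (C * R))) := by gcongr
    _ = ENNReal.ofReal ((3 * L + 1) * C * R) := by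
        rw [← ENNReal.ofReal_add (by positivity) (by positivity),
          ← ENNReal.ofReal_add (by positivity) (by positivity),
          ← ENNReal.ofReal_add (by positivity) (by positivity)]
        congr 1
        ring

end SliceMatching
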